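/- arXiv:2108.07769 — 9 statements merged into one kernel-verified Lean document; each statement's English description precedes it below -/
import Mathlib

section
/- Every credibility-limited revision operator on an epistemic-state framework over a nonempty finite type W is a dynamic-limited revision operator. Moreover, there exist a nonempty finite type W, an epistemic-state framework (E, mod) over W, and a dynamic-limited revision operator on it that is not a credibility-limited revision operator. -/
open Set

/-- A total preorder on a subset `S` of `W`: a relation that relates only elements of `S`,
is transitive, and is total on `S`. -/
def TotalPreorderOn {W : Type*} (S : Set W) (r : W → W → Prop) : Prop :=
  (∀ x y, r x y → x ∈ S ∧ y ∈ S) ∧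
  (∀ x y z, r x y → r y z → r x z) ∧
  (∀ x ∈ S, ∀ y ∈ S, r x y ∨ r y x)

/-- `minOf S r A` is the set of `r`-minimal worlds of `A` within the domain `S`. -/
def minOf {W : Type*} (S : Set W) (r : W → W → Prop) (A : Set W) : Set W :=
  {ω | ω ∈ S ∩ A ∧ ∀ ω' ∈ S ∩ A, r ω ω'}

/-- The scope of an operator at a state: those sets that are believed after revising by them. -/
def Scope {W E : Type*} (mod : E → Set W) (op : E → Set W → E) (Ψ : E) : Set (Set W) :=
  {A | mod (op Ψ A) ⊆ A}

/-- Single-sentence closure of a collection of sets of worlds. -/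
def SSC {W : Type*} (X : Set (Set W)) : Prop :=
  ∀ A ∈ X, ∀ B : Set W, A ⊆ B → B ∈ X

/-- Disjunction completeness of a collection of sets of worlds. -/
def DC {W : Type*} (X : Set (Set W)) : Prop :=
  ∀ A B : Set W, A ∪ B ∈ X → A ∈ X ∨ B ∈ X

/-- A faithful limited assignment: each state gets a nonempty domain `S Ψ` and a
total preorder `tpo Ψ` on it, faithful w.r.t. `mod`. -/
def FaithfulLimited {W E : Type*} (mod : E → Set W)
    (tpo : E → W → W → Prop) (S : E → Set W) : Prop :=
  (∀ Ψ, (S Ψ).Nonempty) ∧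
  (∀ Ψ, TotalPreorderOn (S Ψ) (tpo Ψ)) ∧
  (∀ Ψ, (mod Ψ ∩ S Ψ).Nonempty → minOf (S Ψ) (tpo Ψ) (S Ψ) = mod Ψ ∩ S Ψ)

/-- Compatibility of a limited assignment with a belief change operator. -/
def CompatibleLimited {W E : Type*} (mod : E → Set W) (op : E → Set W → E)
    (tpo : E → W → W → Prop) (S : E → Set W) : Prop :=
  ∀ Ψ A, ((S Ψ ∩ A).Nonempty → mod (op Ψ A) = minOf (S Ψ) (tpo Ψ) A) ∧
    (¬ (S Ψ ∩ A).Nonempty → mod (op Ψ A) = mod Ψ)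

/-- Dynamic-limited revision operator. -/
def DynamicLimited {W E : Type*} (mod : E → Set W) (op : E → Set W → E) : Prop :=
  ∃ (tpo : E → W → W → Prop) (S : E → Set W),
    FaithfulLimited mod tpo S ∧ CompatibleLimited mod op tpo S

/-- Credibility-limited revision operator (postulates CL1, CL2, CL3, CL5, CL6). -/
def CredLimited {W E : Type*} (mod : E → Set W) (op : E → Set W → E) : Prop :=
  ∀ (Ψ : E) (A B : Set W),
    (mod (op Ψ A) ⊆ A ∨ mod (op Ψ A) = mod Ψ) ∧
    ((mod Ψ ∩ A).Nonempty → mod (op Ψ A) = mod Ψ ∩ A) ∧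
    (mod (op Ψ A)).Nonempty ∧
    (mod (op Ψ A) ⊆ A → A ⊆ B → mod (op Ψ B) ⊆ B) ∧
    (mod (op Ψ (A ∪ B)) = mod (op Ψ A) ∨ mod (op Ψ (A ∪ B)) = mod (op Ψ B) ∨
      mod (op Ψ (A ∪ B)) = mod (op Ψ A) ∪ mod (op Ψ B))

/-- Condition (S1). -/
def CondS1 {W E : Type*} (mod : E → Set W) (op : E → Set W → E) (Ψ : E) (A : Set W) : Prop :=
  (mod Ψ ∩ A).Nonempty → ∀ B : Set W, A ⊆ B → mod (op Ψ A) ⊆ mod (op Ψ B)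

/-- Condition (S2). -/
def CondS2 {W E : Type*} (mod : E → Set W) (op : E → Set W → E) (Ψ : E) (A : Set W) : Prop :=
  ∀ B : Set W, mod (op Ψ A) ⊆ mod (op Ψ B) → (mod (op Ψ B) ∩ A).Nonempty

/-- `A` is latent in `Ψ`: `A` and every nonempty subset of `A` satisfy (S1) and (S2). -/
def Latent {W E : Type*} (mod : E → Set W) (op : E → Set W → E) (Ψ : E) (A : Set W) : Prop :=
  (CondS1 mod op Ψ A ∧ CondS2 mod op Ψ A) ∧
  ∀ B : Set W, B ⊆ A → B.Nonempty → CondS1 mod op Ψ B ∧ CondS2 mod op Ψ B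

/-- `A` is reasonable in `Ψ`: `A` is the union of a nonempty family of latent sets. -/
def Reasonable {W E : Type*} (mod : E → Set W) (op : E → Set W → E) (Ψ : E) (A : Set W) : Prop :=
  ∃ F : Set (Set W), F.Nonempty ∧ (∀ B ∈ F, Latent mod op Ψ B) ∧ A = ⋃₀ F

/-- AGM revision operator (via a faithful assignment of total preorders on all of `W`). -/
def AGMRev {W E : Type*} (mod : E → Set W) (op : E → Set W → E) : Prop :=
  ∃ le : E → W → W → Prop,
    (∀ Ψ, TotalPreorderOn Set.univ (le Ψ)) ∧
    (∀ Ψ, minOf Set.univ (le Ψ) Set.univ = mod Ψ) ∧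
    (∀ Ψ A, mod (op Ψ A) = minOf Set.univ (le Ψ) A)

/-- Unbiased framework: every nonempty set of worlds is the belief set of some state. -/
def Unbiased {W E : Type*} (mod : E → Set W) : Prop :=
  ∀ M : Set W, M.Nonempty → ∃ Γ : E, mod Γ = M

/-- `A` is inherent for `op`. -/
def Inherent {W E : Type*} (mod : E → Set W) (op : E → Set W → E) (A : Set W) : Prop :=
  ∀ Γ : E, mod (op Γ A) = A

/-- `A` is immanent for `op`: union of a nonempty family of inherent sets. -/
def Immanent {W E : Type*} (mod : E → Set W) (op : E → Set W → E) (A : Set W) : Prop :=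
  ∃ F : Set (Set W), F.Nonempty ∧ (∀ B ∈ F, Inherent mod op B) ∧ A = ⋃₀ F

/-- Inherence-limited revision operator (postulates IL1-IL5, IL7). -/
def InhLimited {W E : Type*} (mod : E → Set W) (op : E → Set W → E) : Prop :=
  ∀ (Ψ : E) (A B : Set W),
    (mod (op Ψ A) = mod Ψ ∨ mod (op Ψ A) ⊆ A) ∧
    (mod (op Ψ A) = mod Ψ ∨ Immanent mod op (mod (op Ψ A))) ∧
    ((mod Ψ ∩ A).Nonempty → Immanent mod op A → mod (op Ψ A) = mod Ψ ∩ A) ∧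
    (A ⊆ B → Immanent mod op A → Immanent mod op (mod (op Ψ B))) ∧
    ((mod Ψ).Nonempty → (mod (op Ψ A)).Nonempty) ∧
    (mod (op Ψ (A ∪ B)) = mod (op Ψ A) ∨ mod (op Ψ (A ∪ B)) = mod (op Ψ B) ∨
      mod (op Ψ (A ∪ B)) = mod (op Ψ A) ∪ mod (op Ψ B))

theorem cl_aux {W : Type} (f : Set W → Set W) (M : Set W)
    (c1 : ∀ A, f A ⊆ A ∨ f A = M)
    (c2 : ∀ A, (M ∩ A).Nonempty → f A = M ∩ A)
    (c3 : ∀ A, (f A).Nonempty)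
    (c5 : ∀ A B, f A ⊆ A → A ⊆ B → f B ⊆ B)
    (c6 : ∀ A B, f (A ∪ B) = f A ∨ f (A ∪ B) = f B ∨ f (A ∪ B) = f A ∪ f B) :
    ∃ (r : W → W → Prop) (S : Set W), S.Nonempty ∧ TotalPreorderOn S r ∧
      ((M ∩ S).Nonempty → minOf S r S = M ∩ S) ∧
      ∀ A, ((S ∩ A).Nonempty → f A = minOf S r A) ∧ (¬ (S ∩ A).Nonempty → f A = M) := by
  have hM : M.Nonempty := by
    rcases c1 ∅ with h | h
    · obtain ⟨x, hx⟩ := c3 ∅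
      exact absurd (h hx) (by simp)
    · rw [← h]; exact c3 ∅
  have hK : ∀ A B, f A ⊆ A → A ⊆ B → (f B ∩ A).Nonempty → f A = f B ∩ A := by
    intro A B hA hAB hne
    by_cases hMA : (M ∩ A).Nonempty
    · rw [c2 A hMA, c2 B (hMA.mono (inter_subset_inter_right _ hAB)), inter_assoc,
        inter_eq_right.mpr hAB]
    · have hd : ∀ x ∈ f (B \ A), x ∉ A := by
        intro x hx hxA
        rcases c1 (B \ A) with h | h
        · exact (h hx).2 hxA
        · exact hMA ⟨x, h ▸ hx, hxA⟩
      have h6 := c6 A (B \ A)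
      rw [union_diff_cancel hAB] at h6
      obtain ⟨y, hy, hyA⟩ := hne
      ext x
      have h1 := hd x
      have h2 := hd y
      have h3 := @hA x
      rcases h6 with h | h | h <;> rw [h] at hy ⊢ <;> simp only [mem_inter_iff, mem_union] at * <;> tauto
  have hKey : ∀ A, f A ⊆ A → ∀ x ∈ f A, f {x} ⊆ {x} := by
    intro A hA x hx
    by_contra hn
    have hfx : f {x} = M := (c1 {x}).resolve_left hn
    have hxM : x ∉ M := by
      intro h
      apply hn
      rw [c2 {x} ⟨x, h, rfl⟩]
      exact inter_subset_right
    have hMA : ¬ (M ∩ A).Nonempty := by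
      intro h
      rw [c2 A h] at hx
      exact hxM hx.1
    obtain ⟨m, hm⟩ := hM
    have hmf : m ∉ f A := fun h => hMA ⟨m, hm, hA h⟩
    have h6 := c6 {x} (A \ {x})
    rw [union_diff_cancel (singleton_subset_iff.mpr (hA hx)), hfx] at h6
    rcases h6 with h | h | h
    · exact hmf (h ▸ hm)
    · rw [h] at hx
      rcases c1 (A \ {x}) with h' | h'
      · exact (h' hx).2 rfl
      · exact hxM (h' ▸ hx)
    · exact hmf (h ▸ Or.inl hm)
  have hmin : ∀ A, ({w | f {w} ⊆ {w}} ∩ A).Nonempty →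
      f A = minOf {w | f {w} ⊆ {w}}
        (fun x y => f {x} ⊆ {x} ∧ f {y} ⊆ {y} ∧ x ∈ f {x, y}) A := by
    rintro A ⟨w, hw, hwA⟩
    have hA : f A ⊆ A := c5 {w} A hw (singleton_subset_iff.mpr hwA)
    ext x
    constructor
    · intro hx
      have hxS := hKey A hA x hx
      refine ⟨⟨hxS, hA hx⟩, ?_⟩
      rintro y ⟨hyS, hyA⟩
      refine ⟨hxS, hyS, ?_⟩
      rw [hK {x, y} A (c5 {x} _ hxS (by simp)) (by
        rintro z (rfl | rfl)
        · exact hA hx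
        · exact hyA) ⟨x, hx, by simp⟩]
      exact ⟨hx, by simp⟩
    · rintro ⟨⟨hxS, hxA⟩, hx⟩
      obtain ⟨y, hy⟩ := c3 A
      have h := (hx y ⟨hKey A hA y hy, hA hy⟩).2.2
      rw [hK {x, y} A (c5 {x} _ hxS (by simp)) (by
        rintro z (rfl | rfl)
        · exact hxA
        · exact hA hy) ⟨y, hy, by simp⟩] at h
      exact h.1
  have hMS : M ⊆ {w | f {w} ⊆ {w}} := by
    intro w hw
    change f {w} ⊆ {w}
    rw [c2 {w} ⟨w, hw, rfl⟩]
    exact inter_subset_right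
  refine ⟨fun x y => f {x} ⊆ {x} ∧ f {y} ⊆ {y} ∧ x ∈ f {x, y}, {w | f {w} ⊆ {w}},
    hM.mono hMS, ⟨fun x y h => ⟨h.1, h.2.1⟩, ?_, ?_⟩, ?_, ?_⟩
  · rintro x y z ⟨hx, hy, hxy⟩ ⟨_, hz, hyz⟩
    refine ⟨hx, hz, ?_⟩
    have hT : f {x, y, z} ⊆ {x, y, z} := c5 {x} _ hx (by simp)
    have kxy := hK {x, y} {x, y, z} (c5 {x} _ hx (by simp)) (by intro w; simp; tauto)
    have kxz := hK {x, z} {x, y, z} (c5 {x} _ hx (by simp)) (by intro w; simp; tauto)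
    have kyz := hK {y, z} {x, y, z} (c5 {y} _ hy (by simp)) (by intro w; simp; tauto)
    have hxT : x ∈ f {x, y, z} := by
      have hyT : y ∈ f {x, y, z} → x ∈ f {x, y, z} := by
        intro h
        rw [kxy ⟨y, h, by simp⟩] at hxy
        exact hxy.1
      obtain ⟨w, hw⟩ := c3 {x, y, z}
      rcases hT hw with rfl | rfl | rfl
      · exact hw
      · exact hyT hw
      · apply hyT
        rw [kyz ⟨w, hw, by simp⟩] at hyz
        exact hyz.1
    rw [kxz ⟨x, hxT, by simp⟩]
    exact ⟨hxT, by simp⟩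
  · intro x hx y hy
    have hT : f {x, y} ⊆ {x, y} := c5 {x} _ hx (by simp)
    obtain ⟨w, hw⟩ := c3 {x, y}
    rcases hT hw with rfl | rfl
    · exact Or.inl ⟨hx, hy, hw⟩
    · refine Or.inr ⟨hy, hx, ?_⟩
      rw [pair_comm]
      exact hw
  · intro h
    rw [← hmin _ (by rw [inter_self]; exact hM.mono hMS), c2 _ h]
  · intro A
    refine ⟨hmin A, fun hn => ?_⟩
    refine (c1 A).resolve_left fun hA => hn ?_
    obtain ⟨x, hx⟩ := c3 A
    exact ⟨x, hKey A hA x hx, hA hx⟩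

/-- Every credibility-limited revision operator is a dynamic-limited
revision operator, and there is a dynamic-limited revision operator that is not a
credibility-limited revision operator. -/
theorem cred_limited_subsetneq_dynamic_limited :
    (∀ (W E : Type) (_ : Fintype W) (_ : Nonempty W)
        (mod : E → Set W) (op : E → Set W → E),
      CredLimited mod op → DynamicLimited mod op) ∧
    (∃ (W : Type) (_ : Fintype W) (_ : Nonempty W) (E : Type)
        (mod : E → Set W) (op : E → Set W → E),
      DynamicLimited mod op ∧ ¬ CredLimited mod op) := by
  refine ⟨?_, ?_⟩
  · intro W E _ _ mod op h
    have key := fun Ψ => cl_aux (fun A => mod (op Ψ A)) (mod Ψ)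
      (fun A => (h Ψ A A).1) (fun A => (h Ψ A A).2.1) (fun A => (h Ψ A A).2.2.1)
      (fun A B => (h Ψ A B).2.2.2.1) (fun A B => (h Ψ A B).2.2.2.2)
    choose r S h1 h2 h3 h4 using key
    exact ⟨r, S, ⟨h1, h2, h3⟩, h4⟩
  · classical
    refine ⟨Bool, inferInstance, inferInstance, Bool, fun e => {e},
      fun e A => if true ∈ A then true else e, ?_, ?_⟩
    · refine ⟨fun _ x y => x = true ∧ y = true, fun _ => {true}, ⟨?_, ?_, ?_⟩, ?_⟩
      · intro _; exact ⟨true, rfl⟩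
      · intro _
        refine ⟨fun x y h => h, fun x y z h1 h2 => ⟨h1.1, h2.2⟩, ?_⟩
        rintro x rfl y rfl
        exact Or.inl ⟨rfl, rfl⟩
      · rintro Ψ ⟨x, hx1, hx2⟩
        have e1 : x = Ψ := hx1
        have e2 : x = true := hx2
        subst e1
        subst e2
        ext y
        simp [minOf]
      · intro Ψ A
        by_cases hA : true ∈ A
        · refine ⟨fun _ => ?_, fun hn => absurd ⟨true, rfl, hA⟩ hn⟩
          ext y
          simp only [minOf, hA, if_true, mem_singleton_iff, mem_inter_iff, mem_setOf_eq]
          constructor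
          · rintro rfl
            exact ⟨⟨rfl, hA⟩, fun w hw => ⟨rfl, hw.1⟩⟩
          · exact fun hy => hy.1.1
        · refine ⟨?_, fun _ => by simp [hA]⟩
          rintro ⟨x, hx, hxA⟩
          have e : x = true := hx
          exact absurd (e ▸ hxA) hA
    · intro h
      have h2 := (h false univ univ).2.1 ⟨false, rfl, trivial⟩
      simp at h2
end

section
/- Let ⋆ be a dynamic-limited revision operator compatible with a faithful limited assignment Ψ ↦ (⪯_Ψ, S(Ψ)). Then for every state Ψ and every world ω ∈ W: (a) if ω ∈ mod Ψ, then ω ∈ S(Ψ) if and only if {ω} satisfies (S1) in Ψ; (b) if ω ∉ mod Ψ, then ω ∈ S(Ψ) if and only if {ω} satisfies (S2) in Ψ. -/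
open Set

/-- Characterisation of membership in `S(Ψ)` via conditions (S1) and (S2)
on singletons. -/
theorem mem_domain_iff_S1_S2 {W E : Type*} [Fintype W] [Nonempty W]
    (mod : E → Set W) (op : E → Set W → E)
    (tpo : E → W → W → Prop) (S : E → Set W)
    (hfa : FaithfulLimited mod tpo S) (hc : CompatibleLimited mod op tpo S) :
    ∀ (Ψ : E) (ω : W),
      (ω ∈ mod Ψ → (ω ∈ S Ψ ↔ CondS1 mod op Ψ {ω})) ∧
      (ω ∉ mod Ψ → (ω ∈ S Ψ ↔ CondS2 mod op Ψ {ω})) := by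
  obtain ⟨hne, htp, hf⟩ := hfa
  intro Ψ ω
  have hself : ω ∈ S Ψ → mod (op Ψ {ω}) = {ω} := by
    intro h
    rw [(hc Ψ {ω}).1 ⟨ω, h, rfl⟩]
    ext x
    constructor
    · intro hx
      exact hx.1.2
    · intro hx
      have hx' : x = ω := hx
      subst hx'
      refine ⟨⟨h, rfl⟩, ?_⟩
      rintro y ⟨_, hy⟩
      have hy' : y = x := hy
      subst hy'
      exact ((htp Ψ).2.2 y h y h).elim id id
  have hout : ω ∉ S Ψ → mod (op Ψ {ω}) = mod Ψ := by
    intro h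
    apply (hc Ψ {ω}).2
    rintro ⟨x, hx, hx'⟩
    have hx'' : x = ω := hx'
    exact h (hx'' ▸ hx)
  refine ⟨fun hm => ⟨fun h _ B hB => ?_, fun h => ?_⟩,
    fun hm => ⟨fun h B hB => ?_, fun h => ?_⟩⟩
  · have hωB : ω ∈ B := hB rfl
    rw [hself h, (hc Ψ B).1 ⟨ω, h, hωB⟩]
    intro x hx
    have hx' : x = ω := hx
    subst hx'
    have h2 : x ∈ minOf (S Ψ) (tpo Ψ) (S Ψ) := by
      rw [hf Ψ ⟨x, hm, h⟩]
      exact ⟨hm, h⟩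
    exact ⟨⟨h, hωB⟩, fun y hy => h2.2 y ⟨hy.1, hy.1⟩⟩
  · by_contra hn
    have h1 := h ⟨ω, hm, rfl⟩ univ (subset_univ _)
    obtain ⟨s, hs⟩ := hne Ψ
    rw [hout hn, (hc Ψ univ).1 ⟨s, hs, trivial⟩] at h1
    exact hn (h1 hm).1.1
  · refine ⟨ω, hB ?_, rfl⟩
    rw [hself h]
    rfl
  · by_contra hn
    obtain ⟨x, hx, hx'⟩ := h {ω} subset_rfl
    have hx'' : x = ω := hx'
    rw [hout hn, hx''] at hx
    exact hm hx
end

section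
/- Let ⋆ be a dynamic-limited revision operator compatible with a faithful limited assignment Ψ ↦ (⪯_Ψ, S(Ψ)). Then for every state Ψ and every A ⊆ W: A is reasonable in Ψ if and only if A ≠ ∅ and A ⊆ S(Ψ). -/
open Set

/-- `A` is reasonable in `Ψ` iff `A` is nonempty (consistent) and all its
models lie in the domain `S(Ψ)`. -/
theorem reasonable_iff_subset_domain {W E : Type*} [Fintype W] [Nonempty W]
    (mod : E → Set W) (op : E → Set W → E)
    (tpo : E → W → W → Prop) (S : E → Set W)
    (hfa : FaithfulLimited mod tpo S) (hc : CompatibleLimited mod op tpo S) :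
    ∀ (Ψ : E) (A : Set W),
      Reasonable mod op Ψ A ↔ (A.Nonempty ∧ A ⊆ S Ψ) := by
  intro Ψ A
  obtain ⟨hne, hpre, hf⟩ := hfa
  obtain ⟨h1, h2, h3⟩ := hpre Ψ
  constructor
  · rintro ⟨F, ⟨B₀, hB₀⟩, hF, rfl⟩
    constructor
    · obtain ⟨x, -, hx⟩ := (hF B₀ hB₀).1.2 B₀ subset_rfl
      exact ⟨x, B₀, hB₀, hx⟩
    · rintro x ⟨B, hB, hxB⟩
      by_contra hxS
      obtain ⟨hs1, hs2⟩ := (hF B hB).2 {x} (by simpa using hxB) ⟨x, rfl⟩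
      have hm : mod (op Ψ {x}) = mod Ψ := by
        apply (hc Ψ {x}).2
        rintro ⟨y, hy, hyx⟩
        rw [mem_singleton_iff] at hyx
        exact hxS (hyx ▸ hy)
      have hn := hs2 {x} subset_rfl
      rw [hm] at hn
      have hsub := hs1 hn univ (subset_univ _)
      have hu := (hc Ψ univ).1 (by simpa using hne Ψ)
      rw [hm, hu] at hsub
      obtain ⟨y, hy, hyx⟩ := hn
      rw [mem_singleton_iff] at hyx
      subst hyx
      exact hxS (hsub hy).1.1
  · rintro ⟨⟨a, ha⟩, hA⟩
    have key : ∀ x ∈ A, CondS1 mod op Ψ {x} ∧ CondS2 mod op Ψ {x} := by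
      intro x hx
      have hxS := hA hx
      have hm : mod (op Ψ {x}) = {x} := by
        rw [(hc Ψ {x}).1 ⟨x, hxS, rfl⟩]
        ext y
        constructor
        · rintro ⟨⟨-, hy⟩, -⟩
          exact hy
        · intro hy
          rw [mem_singleton_iff] at hy
          subst hy
          refine ⟨⟨hxS, rfl⟩, ?_⟩
          rintro z ⟨-, hz⟩
          rw [mem_singleton_iff] at hz
          subst hz
          exact (h3 z hxS z hxS).elim id id
      constructor
      · rintro ⟨y, hy, hyx⟩ B hB
        rw [mem_singleton_iff] at hyx
        subst hyx
        have hyB : y ∈ B := hB rfl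
        have hmin : y ∈ minOf (S Ψ) (tpo Ψ) (S Ψ) := by
          rw [hf Ψ ⟨y, hy, hxS⟩]
          exact ⟨hy, hxS⟩
        rw [hm, (hc Ψ B).1 ⟨y, hxS, hyB⟩, singleton_subset_iff]
        exact ⟨⟨hxS, hyB⟩, fun z hz => hmin.2 z ⟨hz.1, hz.1⟩⟩
      · intro B hB
        rw [hm] at hB
        exact ⟨x, hB rfl, rfl⟩
    refine ⟨(fun x => ({x} : Set W)) '' A, ⟨_, a, ha, rfl⟩, ?_, ?_⟩
    · rintro _ ⟨x, hx, rfl⟩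
      refine ⟨key x hx, fun B hB hBn => ?_⟩
      rw [(hBn.subset_singleton_iff).1 hB]
      exact key x hx
    · ext y
      simp
end

section
/- Let ⋆ be a dynamic-limited revision operator compatible with a faithful limited assignment Ψ ↦ (⪯_Ψ, S(Ψ)). Then for every state Ψ: Scope(⋆, Ψ) = {A ⊆ W | mod Ψ ⊆ A} ∪ {A ⊆ W | there is B ⊆ A which is reasonable in Ψ}, and also Scope(⋆, Ψ) = {A ⊆ W | mod Ψ ⊆ A} ∪ {A ⊆ W | A ∩ S(Ψ) ≠ ∅}. -/
open Set

/-- Syntactic and semantic characterisation of the scope of a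
dynamic-limited revision operator. -/
theorem scope_characterisation {W E : Type*} [Fintype W] [Nonempty W]
    (mod : E → Set W) (op : E → Set W → E)
    (tpo : E → W → W → Prop) (S : E → Set W)
    (hfa : FaithfulLimited mod tpo S) (hc : CompatibleLimited mod op tpo S) :
    ∀ Ψ : E,
      Scope mod op Ψ =
        {A : Set W | mod Ψ ⊆ A} ∪ {A : Set W | ∃ B ⊆ A, Reasonable mod op Ψ B} ∧
      Scope mod op Ψ =
        {A : Set W | mod Ψ ⊆ A} ∪ {A : Set W | (A ∩ S Ψ).Nonempty} := by
  intro Ψ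
  obtain ⟨hne, htp, hf⟩ := hfa
  have h2 : Scope mod op Ψ =
        {A : Set W | mod Ψ ⊆ A} ∪ {A : Set W | (A ∩ S Ψ).Nonempty} := by
    ext A
    simp only [Scope, mem_setOf_eq, mem_union]
    by_cases h : (S Ψ ∩ A).Nonempty
    · rw [(hc Ψ A).1 h]
      exact ⟨fun _ => Or.inr (by rwa [inter_comm]), fun _ x hx => hx.1.2⟩
    · rw [(hc Ψ A).2 h, inter_comm A]
      simp [h]
  refine ⟨?_, h2⟩
  rw [h2]
  ext A
  simp only [mem_setOf_eq, mem_union]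
  refine or_congr Iff.rfl ⟨?_, ?_⟩
  · rintro ⟨w, hwA, hwS⟩
    have hr : tpo Ψ w w := by
      rcases (htp Ψ).2.2 w hwS w hwS with h | h <;> exact h
    have hm : mod (op Ψ {w}) = {w} := by
      rw [(hc Ψ {w}).1 ⟨w, hwS, rfl⟩]
      ext x
      constructor
      · intro hx
        exact hx.1.2
      · rintro rfl
        refine ⟨⟨hwS, rfl⟩, ?_⟩
        rintro y ⟨_, rfl⟩
        exact hr
    have hL : CondS1 mod op Ψ {w} ∧ CondS2 mod op Ψ {w} := by
      constructor
      · rintro ⟨x, hx, rfl⟩ B hB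
        have hxB : x ∈ B := hB rfl
        rw [hm, (hc Ψ B).1 ⟨x, hwS, hxB⟩]
        rintro y rfl
        have hy : y ∈ minOf (S Ψ) (tpo Ψ) (S Ψ) := by
          rw [hf Ψ ⟨y, hx, hwS⟩]
          exact ⟨hx, hwS⟩
        exact ⟨⟨hwS, hxB⟩, fun z hz => hy.2 z ⟨hz.1, hz.1⟩⟩
      · intro B hB
        rw [hm] at hB
        exact ⟨w, hB rfl, rfl⟩
    refine ⟨{w}, by simpa using hwA, {{w}}, singleton_nonempty _, ?_, by simp⟩
    rintro B rfl
    refine ⟨hL, fun C hC hCn => ?_⟩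
    rw [hCn.subset_singleton_iff.1 hC]
    exact hL
  · rintro ⟨B, hBA, F, ⟨C, hCF⟩, hF, rfl⟩
    obtain ⟨⟨s1, s2⟩, _⟩ := hF C hCF
    have hCA : C ⊆ A := (subset_sUnion_of_mem hCF).trans hBA
    by_cases h : (S Ψ ∩ C).Nonempty
    · obtain ⟨x, hx, hx'⟩ := h
      exact ⟨x, hCA hx', hx⟩
    · exfalso
      have hn := s2 C Subset.rfl
      rw [(hc Ψ C).2 h] at hn
      have h1 := s1 hn univ (subset_univ _)
      rw [(hc Ψ C).2 h, (hc Ψ univ).1 (by simpa using hne Ψ)] at h1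
      obtain ⟨x, hx, hxC⟩ := hn
      exact h ⟨x, (h1 hx).1.1, hxC⟩
end

section
/- Let ⋆ be a dynamic-limited revision operator compatible with a faithful limited assignment Ψ ↦ (⪯_Ψ, S(Ψ)). Then ⋆ satisfies (DP3) — for all Ψ ∈ E and A, B ⊆ W, mod(Ψ ⋆ B) ⊆ A implies mod((Ψ ⋆ A) ⋆ B) ⊆ A — if and only if for all Ψ ∈ E and A ⊆ W: (i) for all ω1 ∈ A and ω2 ∉ A with ω1, ω2 ∈ S(Ψ) ∩ S(Ψ ⋆ A): ω1 ≺_Ψ ω2 implies ω1 ≺_{Ψ⋆A} ω2; (ii) for all ω1 ∈ A and ω2 ∉ A with ω1 ≺_Ψ ω2: ω2 ∈ S(Ψ ⋆ A) implies ω1 ∈ S(Ψ ⋆ A); (iii) for all ω ∉ A, if mod Ψ ⊆ A then ω ∈ S(Ψ ⋆ A) implies ω ∈ S(Ψ); (iv) for all ω1 ∈ A and ω2 ∉ A with ω1 ∈ S(Ψ) and ω2 ∈ S(Ψ ⋆ A): if ω1 ∉ S(Ψ ⋆ A) or ω2 ⪯_{Ψ⋆A} ω1, then ω2 ∈ S(Ψ).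 -/
open Set

theorem exists_minOf_aux {W : Type*} [Fintype W] {S : Set W} {r : W → W → Prop}
    (h : TotalPreorderOn S r) (A : Set W) (hA : (S ∩ A).Nonempty) : (minOf S r A).Nonempty := by
  obtain ⟨h1, h2, h3⟩ := h
  have key : ∀ T : Set W, T.Finite → T ⊆ S → T.Nonempty → ∃ m ∈ T, ∀ x ∈ T, r m x := by
    intro T hT
    induction T, hT using Set.Finite.induction_on with
    | empty => intro _ h; exact absurd h Set.not_nonempty_empty
    | @insert a s ha hs ih =>
      intro hsub _
      have haS : a ∈ S := hsub (Set.mem_insert _ _)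
      have haa : r a a := by have := h3 a haS a haS; tauto
      rcases s.eq_empty_or_nonempty with rfl | hne
      · exact ⟨a, Set.mem_insert _ _, by simpa using haa⟩
      · obtain ⟨m, hm, hmin⟩ := ih (fun x hx => hsub (Set.mem_insert_of_mem _ hx)) hne
        rcases h3 a haS m (hsub (Set.mem_insert_of_mem _ hm)) with h | h
        · refine ⟨a, Set.mem_insert _ _, ?_⟩
          rintro x (rfl | hx)
          · exact haa
          · exact h2 _ _ _ h (hmin x hx)
        · refine ⟨m, Set.mem_insert_of_mem _ hm, ?_⟩
          rintro x (rfl | hx)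
          · exact h
          · exact hmin x hx
  obtain ⟨m, hm, hmin⟩ := key (S ∩ A) (Set.toFinite _) Set.inter_subset_left hA
  exact ⟨m, hm, hmin⟩

/-- Characterisation of (DP3) for dynamic-limited revision operators. -/
theorem dp3_characterisation {W E : Type*} [Fintype W] [Nonempty W]
    (mod : E → Set W) (op : E → Set W → E)
    (tpo : E → W → W → Prop) (S : E → Set W)
    (hfa : FaithfulLimited mod tpo S) (hc : CompatibleLimited mod op tpo S) :
    (∀ (Ψ : E) (A B : Set W), mod (op Ψ B) ⊆ A → mod (op (op Ψ A) B) ⊆ A) ↔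
    (∀ (Ψ : E) (A : Set W),
      (∀ ω1 ω2 : W, ω1 ∈ A → ω2 ∉ A →
        ω1 ∈ S Ψ ∩ S (op Ψ A) → ω2 ∈ S Ψ ∩ S (op Ψ A) →
        (tpo Ψ ω1 ω2 ∧ ¬ tpo Ψ ω2 ω1) →
        (tpo (op Ψ A) ω1 ω2 ∧ ¬ tpo (op Ψ A) ω2 ω1)) ∧
      (∀ ω1 ω2 : W, ω1 ∈ A → ω2 ∉ A → (tpo Ψ ω1 ω2 ∧ ¬ tpo Ψ ω2 ω1) →
        ω2 ∈ S (op Ψ A) → ω1 ∈ S (op Ψ A)) ∧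
      (∀ ω : W, ω ∉ A → mod Ψ ⊆ A → ω ∈ S (op Ψ A) → ω ∈ S Ψ) ∧
      (∀ ω1 ω2 : W, ω1 ∈ A → ω2 ∉ A → ω1 ∈ S Ψ → ω2 ∈ S (op Ψ A) →
        (ω1 ∉ S (op Ψ A) ∨ tpo (op Ψ A) ω2 ω1) → ω2 ∈ S Ψ)) := by
  obtain ⟨-, ht, -⟩ := hfa
  constructor
  · intro dp Ψ A
    -- a world outside A that is minimal for a pair yields a contradiction
    have key : ∀ (B : Set W) (ω : W), ω ∉ A → mod (op Ψ B) ⊆ A → ω ∈ S (op Ψ A) → ω ∈ B →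
        (∀ x ∈ S (op Ψ A) ∩ B, tpo (op Ψ A) ω x) → False := by
      intro B ω hω hB hS hωB hmin
      apply hω
      apply dp Ψ A B hB
      rw [(hc (op Ψ A) B).1 ⟨ω, hS, hωB⟩]
      exact ⟨⟨hS, hωB⟩, hmin⟩
    have hrefl : ∀ Φ, ∀ x ∈ S Φ, tpo Φ x x := by
      intro Φ x hx
      have := (ht Φ).2.2 x hx x hx
      tauto
    have pair : ∀ ω1 ω2 : W, ω1 ∈ A → ω1 ∈ S Ψ → (ω2 ∈ S Ψ → ¬ tpo Ψ ω2 ω1) →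
        mod (op Ψ {ω1, ω2}) ⊆ A := by
      intro ω1 ω2 h1 hS1 h2
      rw [(hc Ψ {ω1, ω2}).1 ⟨ω1, hS1, by simp⟩]
      rintro x ⟨⟨hxS, rfl | rfl⟩, hx⟩
      · exact h1
      · exact absurd (hx ω1 ⟨hS1, by simp⟩) (h2 hxS)
    refine ⟨?_, ?_, ?_, ?_⟩
    · intro ω1 ω2 h1 h2 hS1 hS2 hlt
      have hn : ¬ tpo (op Ψ A) ω2 ω1 := by
        intro h
        refine key {ω1, ω2} ω2 h2 (pair ω1 ω2 h1 hS1.1 (fun _ => hlt.2)) hS2.2 (by simp) ?_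
        rintro x ⟨hxS, rfl | rfl⟩
        · exact h
        · exact hrefl _ _ hxS
      exact ⟨((ht _).2.2 ω1 hS1.2 ω2 hS2.2).resolve_right hn, hn⟩
    · intro ω1 ω2 h1 h2 hlt hS2
      by_contra hS1
      refine key {ω1, ω2} ω2 h2
        (pair ω1 ω2 h1 ((ht _).1 _ _ hlt.1).1 (fun _ => hlt.2)) hS2 (by simp) ?_
      rintro x ⟨hxS, rfl | rfl⟩
      · exact absurd hxS hS1
      · exact hrefl _ _ hxS
    · intro ω hω hm hS
      by_contra hn
      refine key {ω} ω hω ?_ hS rfl ?_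
      · rw [(hc Ψ {ω}).2]
        · exact hm
        · rintro ⟨x, hx, rfl⟩
          exact hn hx
      · rintro x ⟨hxS, rfl⟩
        exact hrefl _ _ hxS
    · intro ω1 ω2 h1 h2 hS1 hS2 hor
      by_contra hn
      refine key {ω1, ω2} ω2 h2 (pair ω1 ω2 h1 hS1 (fun h => absurd h hn)) hS2 (by simp) ?_
      rintro x ⟨hxS, rfl | rfl⟩
      · exact hor.resolve_left (fun h => h hxS)
      · exact hrefl _ _ hxS
  · intro H Ψ A B hB
    obtain ⟨c1, c2, c3, c4⟩ := H Ψ A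
    by_cases hS' : (S (op Ψ A) ∩ B).Nonempty
    · rw [(hc (op Ψ A) B).1 hS']
      rintro ω2 ⟨⟨hS2, hB2⟩, hmin⟩
      by_contra h2
      by_cases hS : (S Ψ ∩ B).Nonempty
      · rw [(hc Ψ B).1 hS] at hB
        obtain ⟨ω1, hm1⟩ := exists_minOf_aux (ht Ψ) B hS
        have h1 := hB hm1
        obtain ⟨⟨hS1, hB1⟩, hmin1⟩ := hm1
        by_cases hS2' : ω2 ∈ S Ψ
        · have hlt : ¬ tpo Ψ ω2 ω1 := fun h =>
            h2 (hB ⟨⟨hS2', hB2⟩, fun x hx => (ht Ψ).2.1 _ _ _ h (hmin1 x hx)⟩)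
          have hle := hmin1 ω2 ⟨hS2', hB2⟩
          have hS1' := c2 ω1 ω2 h1 h2 ⟨hle, hlt⟩ hS2
          exact (c1 ω1 ω2 h1 h2 ⟨hS1, hS1'⟩ ⟨hS2', hS2⟩ ⟨hle, hlt⟩).2 (hmin ω1 ⟨hS1', hB1⟩)
        · apply hS2'
          apply c4 ω1 ω2 h1 h2 hS1 hS2
          by_cases h : ω1 ∈ S (op Ψ A)
          · exact Or.inr (hmin ω1 ⟨h, hB1⟩)
          · exact Or.inl h
      · rw [(hc Ψ B).2 hS] at hB
        exact hS ⟨ω2, c3 ω2 h2 hB hS2, hB2⟩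
    · rw [(hc (op Ψ A) B).2 hS']
      by_cases hA : (S Ψ ∩ A).Nonempty
      · rw [(hc Ψ A).1 hA]
        exact fun x hx => hx.1.2
      · rw [(hc Ψ A).2 hA]
        by_cases hS : (S Ψ ∩ B).Nonempty
        · rw [(hc Ψ B).1 hS] at hB
          obtain ⟨ω1, hm1⟩ := exists_minOf_aux (ht Ψ) B hS
          exact absurd ⟨ω1, hm1.1.1, hB hm1⟩ hA
        · rwa [(hc Ψ B).2 hS] at hB
end

section
/- Let ⋆ be a dynamic-limited revision operator compatible with a faithful limited assignment Ψ ↦ (⪯_Ψ, S(Ψ)), and fix Ψ ∈ E and A ⊆ W. Then: (a) Scope(⋆, Ψ) ⊆ Scope(⋆, Ψ ⋆ A) if and only if both (SI1): for every B ⊆ W, B ∩ S(Ψ) ≠ ∅ implies B ∩ S(Ψ ⋆ A) ≠ ∅ or mod(Ψ ⋆ A) ⊆ B; and (SI2): for every B ⊆ W, if mod Ψ ⊆ B and not mod(Ψ ⋆ A) ⊆ B, then B ∩ S(Ψ ⋆ A) ≠ ∅. (b) Scope(⋆, Ψ ⋆ A) ⊆ Scope(⋆, Ψ) if and only if both (SD1):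 for every B ⊆ W, B ∩ S(Ψ ⋆ A) ≠ ∅ implies B ∩ S(Ψ) ≠ ∅ or mod Ψ ⊆ B; and (SD2): for every B ⊆ W, if mod(Ψ ⋆ A) ⊆ B and not mod Ψ ⊆ B, then B ∩ S(Ψ) ≠ ∅. -/
open Set

theorem mem_scope_iff_aux {W E : Type*} {mod : E → Set W} {op : E → Set W → E}
    {tpo : E → W → W → Prop} {S : E → Set W} (hc : CompatibleLimited mod op tpo S)
    (Ψ : E) (B : Set W) :
    B ∈ Scope mod op Ψ ↔ ((B ∩ S Ψ).Nonempty ∨ mod Ψ ⊆ B) := by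
  obtain ⟨h1, h2⟩ := hc Ψ B
  rw [Set.inter_comm] at h1 h2
  show mod (op Ψ B) ⊆ B ↔ _
  by_cases h : (B ∩ S Ψ).Nonempty
  · rw [h1 h]
    exact ⟨fun _ => Or.inl h, fun _ x hx => hx.1.2⟩
  · rw [h2 h]
    simp [h]

/-- Characterisation of monotone scope dynamics via (SI1),(SI2) and
(SD1),(SD2). -/
theorem scope_monotone_characterisation {W E : Type*} [Fintype W] [Nonempty W]
    (mod : E → Set W) (op : E → Set W → E)
    (tpo : E → W → W → Prop) (S : E → Set W)
    (hfa : FaithfulLimited mod tpo S) (hc : CompatibleLimited mod op tpo S)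
    (Ψ : E) (A : Set W) :
    (Scope mod op Ψ ⊆ Scope mod op (op Ψ A) ↔
      ((∀ B : Set W, (B ∩ S Ψ).Nonempty →
          ((B ∩ S (op Ψ A)).Nonempty ∨ mod (op Ψ A) ⊆ B)) ∧
       (∀ B : Set W, mod Ψ ⊆ B → ¬ mod (op Ψ A) ⊆ B →
          (B ∩ S (op Ψ A)).Nonempty))) ∧
    (Scope mod op (op Ψ A) ⊆ Scope mod op Ψ ↔
      ((∀ B : Set W, (B ∩ S (op Ψ A)).Nonempty →
          ((B ∩ S Ψ).Nonempty ∨ mod Ψ ⊆ B)) ∧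
       (∀ B : Set W, mod (op Ψ A) ⊆ B → ¬ mod Ψ ⊆ B →
          (B ∩ S Ψ).Nonempty))) := by
  simp only [Set.subset_def (s := Scope mod op _), mem_scope_iff_aux hc]
  constructor
  · constructor
    · intro h
      exact ⟨fun B hB => h B (Or.inl hB), fun B h1 h2 => (h B (Or.inr h1)).resolve_right h2⟩
    · rintro ⟨h1, h2⟩ B (hB | hB)
      · exact h1 B hB
      · by_cases h : mod (op Ψ A) ⊆ B
        · exact Or.inr h
        · exact Or.inl (h2 B hB h)
  · constructor
    · intro h
      exact ⟨fun B hB => h B (Or.inl hB), fun B h1 h2 => (h B (Or.inr h1)).resolve_right h2⟩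
    · rintro ⟨h1, h2⟩ B (hB | hB)
      · exact h1 B hB
      · by_cases h : mod Ψ ⊆ B
        · exact Or.inr h
        · exact Or.inl (h2 B hB h)
end

section
/- Let (E, mod) be an unbiased epistemic-state framework over W, let ∘ be a credibility-limited revision operator on it, and let Ψ ↦ (≤_Ψ, C_Ψ) be a CLF-assignment compatible with ∘. Then a set A ⊆ W is inherent for ∘ if and only if there is a world ω with A = {ω} and ω ∈ C_Γ for every Γ ∈ E. -/
open Set

/-- For a credibility-limited revision operator with a compatible
CLF-assignment on an unbiased framework, the inherent sets are exactly the singletons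
of worlds credible in every state. -/
theorem cred_limited_inherent {W E : Type*} [Fintype W] [Nonempty W]
    (mod : E → Set W) (hub : Unbiased mod)
    (op : E → Set W → E) (hcl : CredLimited mod op)
    (le : E → W → W → Prop) (C : E → Set W)
    (hclf : ∀ Ψ : E, mod Ψ ⊆ C Ψ ∧ TotalPreorderOn (C Ψ) (le Ψ) ∧
      minOf (C Ψ) (le Ψ) (C Ψ) = mod Ψ)
    (hcomp : ∀ (Ψ : E) (A : Set W),
      ((A ∩ C Ψ).Nonempty → mod (op Ψ A) = minOf (C Ψ) (le Ψ) A) ∧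
      (¬ (A ∩ C Ψ).Nonempty → mod (op Ψ A) = mod Ψ)) :
    ∀ A : Set W, Inherent mod op A ↔
      ∃ ω : W, A = {ω} ∧ ∀ Γ : E, ω ∈ C Γ := by
  intro A
  constructor
  · intro h
    obtain ⟨Γ₀, -⟩ := hub Set.univ Set.univ_nonempty
    have hne : A.Nonempty := by
      have := (hcl Γ₀ A A).2.2.1
      rwa [h Γ₀] at this
    obtain ⟨ω, hω⟩ := hne
    obtain ⟨Γ, hΓ⟩ := hub {ω} (Set.singleton_nonempty ω)
    have h2 := (hcl Γ A A).2.1 (by rw [hΓ]; exact ⟨ω, rfl, hω⟩)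
    rw [h Γ, hΓ] at h2
    have hA : A = {ω} := by
      rw [h2]
      exact Set.inter_eq_left.mpr (by simpa using hω)
    refine ⟨ω, hA, fun Δ => ?_⟩
    by_contra hc
    have h3 := (hcomp Δ A).2 (by
      rintro ⟨x, hx, hx'⟩
      rw [hA] at hx
      have : x = ω := hx
      subst this
      exact hc hx')
    rw [h Δ] at h3
    exact hc ((hclf Δ).1 (h3 ▸ hω))
  · rintro ⟨ω, rfl, hC⟩ Γ
    rw [(hcomp Γ {ω}).1 ⟨ω, rfl, hC Γ⟩]
    ext x
    constructor
    · intro hx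
      exact hx.1.2
    · intro hx
      have : x = ω := hx
      subst this
      refine ⟨⟨hC Γ, rfl⟩, ?_⟩
      rintro y ⟨-, hy⟩
      have : y = x := hy
      subst this
      exact ((hclf Γ).2.1.2.2 y (hC Γ) y (hC Γ)).elim id id
end

section
/- Let (E, mod) be an unbiased epistemic-state framework over W and let ∘ be an inherence-limited revision operator on it. If A ⊆ W is immanent for ∘, then {ω} is inherent for ∘ for every ω ∈ A. -/
open Set

/-- Every model of an immanent set of an inherence-limited revision
operator forms an inherent singleton. -/
theorem immanent_models_inherent {W E : Type*} [Fintype W] [Nonempty W]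
    (mod : E → Set W) (hub : Unbiased mod)
    (op : E → Set W → E) (hil : InhLimited mod op) :
    ∀ A : Set W, Immanent mod op A → ∀ ω ∈ A, Inherent mod op ({ω} : Set W) := by
  rintro A ⟨F, -, hF, rfl⟩ ω ⟨B, hB, hω⟩
  obtain ⟨Γ, hΓ⟩ := hub {ω} (Set.singleton_nonempty ω)
  have hI : Immanent mod op B :=
    ⟨{B}, Set.singleton_nonempty B, fun C hC => by
      rw [Set.mem_singleton_iff.mp hC]; exact hF B hB, by simp⟩
  have h3 := (hil Γ B B).2.2.1 (by rw [hΓ]; exact ⟨ω, rfl, hω⟩) hI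
  rw [hF B hB Γ, hΓ, Set.inter_eq_left.mpr (Set.singleton_subset_iff.mpr hω)] at h3
  rw [← h3]
  exact hF B hB
end

section
/- Let (E, mod) be an unbiased epistemic-state framework over W. A belief change operator ∘ is both an inherence-limited revision operator and a credibility-limited revision operator if and only if there is an assignment Ψ ↦ ≤_Ψ of total preorders on all of W such that for every state Ψ ∈ E: min(W, ≤_Ψ) = mod Ψ, mod(Ψ ∘ A) = min(A, ≤_Ψ) for every nonempty A ⊆ W, and mod(Ψ ∘ ∅) = mod Ψ (that is, ∘ is an AGM revision operator on consistent inputs). -/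
open Set

theorem aux_min_nonempty {W : Type*} [Fintype W] (r : W → W → Prop)
    (h : TotalPreorderOn Set.univ r) (A : Set W) (hA : A.Nonempty) :
    (minOf Set.univ r A).Nonempty := by
  obtain ⟨_, ht, htot⟩ := h
  induction A, A.toFinite using Set.Finite.induction_on with
  | empty => exact absurd hA (by simp)
  | @insert a s _ _ ih =>
    rcases s.eq_empty_or_nonempty with rfl | hs
    · refine ⟨a, ⟨by simp, ?_⟩⟩
      intro y hy
      have : y = a := by simpa using hy
      subst this
      exact (htot y trivial y trivial).elim id id
    · obtain ⟨m, ⟨_, hm⟩, hmin⟩ := ih hs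
      rcases htot a trivial m trivial with h1 | h1
      · refine ⟨a, ⟨by simp, ?_⟩⟩
        rintro y ⟨_, rfl | hy⟩
        · exact (htot y trivial y trivial).elim id id
        · exact ht _ _ _ h1 (hmin y ⟨trivial, hy⟩)
      · refine ⟨m, ⟨⟨trivial, Or.inr hm⟩, ?_⟩⟩
        rintro y ⟨_, rfl | hy⟩
        · exact h1
        · exact hmin y ⟨trivial, hy⟩

theorem aux_min_tri {W : Type*} [Fintype W] (r : W → W → Prop)
    (h : TotalPreorderOn Set.univ r) (A B : Set W) (hA : A.Nonempty) (hB : B.Nonempty) :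
    minOf Set.univ r (A ∪ B) = minOf Set.univ r A ∨
    minOf Set.univ r (A ∪ B) = minOf Set.univ r B ∨
    minOf Set.univ r (A ∪ B) = minOf Set.univ r A ∪ minOf Set.univ r B := by
  obtain ⟨a, ⟨_, ha⟩, ham⟩ := aux_min_nonempty r h A hA
  obtain ⟨b, ⟨_, hb⟩, hbm⟩ := aux_min_nonempty r h B hB
  obtain ⟨_, ht, htot⟩ := h
  simp only [Set.univ_inter] at ham hbm
  by_cases h1 : r a b
  · by_cases h2 : r b a
    · right; right
      ext x
      simp only [minOf, Set.univ_inter, Set.mem_setOf_eq, Set.mem_union]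
      grind
    · left
      ext x
      simp only [minOf, Set.univ_inter, Set.mem_setOf_eq, Set.mem_union]
      grind
  · have h2 : r b a := (htot a trivial b trivial).resolve_left h1
    right; left
    ext x
    simp only [minOf, Set.univ_inter, Set.mem_setOf_eq, Set.mem_union]
    grind

theorem aux_min_inter {W : Type*} (r : W → W → Prop)
    (h : TotalPreorderOn Set.univ r) (A : Set W)
    (hA : (minOf Set.univ r Set.univ ∩ A).Nonempty) :
    minOf Set.univ r A = minOf Set.univ r Set.univ ∩ A := by
  obtain ⟨a, ⟨_, ha⟩, haA⟩ := hA
  obtain ⟨_, ht, htot⟩ := h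
  ext x
  simp only [minOf, Set.univ_inter, Set.mem_setOf_eq, Set.mem_inter_iff, Set.mem_univ,
    true_and, true_implies] at *
  constructor
  · rintro ⟨hx, hm⟩
    exact ⟨fun y => ht _ _ _ (hm a haA) (ha y), hx⟩
  · rintro ⟨hm, hx⟩
    exact ⟨hx, fun y _ => hm y⟩

theorem aux_singleton_inh {W E : Type*}
    (mod : E → Set W) (hub : Unbiased mod) (op : E → Set W → E)
    (hI : InhLimited mod op) (hC : CredLimited mod op) (w : W) :
    Inherent mod op {w} := by
  by_cases hW : (Set.univ : Set W) = {w}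
  · intro Γ
    obtain ⟨x, hx⟩ := (hC Γ {w} ∅).2.2.1
    have hall : ∀ y : W, y = w := fun y => by
      have : y ∈ (Set.univ : Set W) := trivial
      rw [hW] at this; exact this
    ext y
    have h1 := hall y
    have h2 := hall x
    subst h1
    subst h2
    simp [hx]
  · obtain ⟨Γ, hΓ⟩ := hub Set.univ ⟨w, trivial⟩
    have h1 : mod (op Γ {w}) = {w} := by
      have := (hC Γ {w} ∅).2.1 (by rw [hΓ]; exact ⟨w, trivial, rfl⟩)
      rw [this, hΓ, Set.univ_inter]
    rcases (hI Γ {w} ∅).2.1 with h2 | h2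
    · exact absurd (by rw [← hΓ, ← h2, h1]) hW
    · rw [h1] at h2
      obtain ⟨F, _, hF, hU⟩ := h2
      have hw : w ∈ ⋃₀ F := by rw [← hU]; rfl
      obtain ⟨B, hB, hwB⟩ := hw
      have hBw : B = {w} := by
        apply Set.Subset.antisymm
        · rw [hU]; exact Set.subset_sUnion_of_mem hB
        · simpa using hwB
      exact hBw ▸ hF B hB

theorem aux_imm {W E : Type*} (mod : E → Set W) (op : E → Set W → E)
    (h : ∀ w, Inherent mod op {w}) (A : Set W) (hA : A.Nonempty) : Immanent mod op A := by
  refine ⟨(fun w => {w}) '' A, hA.image _, ?_, ?_⟩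
  · rintro _ ⟨w, _, rfl⟩
    exact h w
  · ext x; simp

theorem aux_arrow {W : Type*} (C : Set W → Set W)
    (hsub : ∀ A : Set W, A.Nonempty → C A ⊆ A)
    (htri : ∀ A B, C (A ∪ B) = C A ∨ C (A ∪ B) = C B ∨ C (A ∪ B) = C A ∪ C B)
    (A D : Set W) (hAD : A ⊆ D) (h : (C D ∩ A).Nonempty) : C A = C D ∩ A := by
  have hA : A.Nonempty := h.mono Set.inter_subset_right
  have hCA := hsub A hA
  rcases (D \ A).eq_empty_or_nonempty with he | hne
  · have : D = A := Set.Subset.antisymm (Set.sdiff_eq_empty.mp he) hAD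
    subst this
    exact (Set.inter_eq_left.mpr hCA).symm
  · have hCB := hsub _ hne
    have hu : A ∪ D \ A = D := Set.union_sdiff_cancel hAD
    have ht := htri A (D \ A)
    rw [hu] at ht
    have hz : C (D \ A) ∩ A = ∅ := by
      ext x
      simp only [Set.mem_inter_iff, Set.mem_empty_iff_false, iff_false]
      rintro ⟨h1, h2⟩
      exact (hCB h1).2 h2
    rcases ht with ht | ht | ht
    · rw [ht]; exact (Set.inter_eq_left.mpr hCA).symm
    · rw [ht, hz] at h; exact absurd h (by simp)
    · rw [ht, Set.union_inter_distrib_right, hz, Set.union_empty]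
      exact (Set.inter_eq_left.mpr hCA).symm

theorem aux_repr {W : Type*} (C : Set W → Set W)
    (hsub : ∀ A : Set W, A.Nonempty → C A ⊆ A) (hne : ∀ A, (C A).Nonempty)
    (htri : ∀ A B, C (A ∪ B) = C A ∨ C (A ∪ B) = C B ∨ C (A ∪ B) = C A ∪ C B) :
    TotalPreorderOn Set.univ (fun x y => x ∈ C {x, y}) ∧
    ∀ A : Set W, A.Nonempty → C A = minOf Set.univ (fun x y => x ∈ C {x, y}) A := by
  have key : ∀ (D : Set W) (x y : W), x ∈ D → y ∈ D → (x ∈ C D ∨ y ∈ C D) →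
      (x ∈ C {x, y} ↔ x ∈ C D) := by
    intro D x y hx hy h
    have hh : C {x, y} = C D ∩ {x, y} := by
      apply aux_arrow C hsub htri
      · rintro z (rfl | rfl) <;> assumption
      · rcases h with h | h
        · exact ⟨x, h, by simp⟩
        · exact ⟨y, h, by simp⟩
    rw [hh]; simp
  refine ⟨⟨fun _ _ _ => ⟨trivial, trivial⟩, ?_, ?_⟩, ?_⟩
  · intro x y z hxy hyz
    have hD : ({x, y, z} : Set W).Nonempty := ⟨x, by simp⟩
    obtain ⟨w, hw⟩ := hne {x, y, z}
    have hw2 := hsub _ hD hw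
    have h1 := key {x, y, z} x y (by simp) (by simp)
    have h2 := key {x, y, z} y z (by simp) (by simp)
    have h3 := key {x, y, z} x z (by simp) (by simp)
    have hx : x ∈ C {x, y, z} := by
      rcases hw2 with rfl | rfl | rfl
      · exact hw
      · exact (h1 (Or.inr hw)).1 hxy
      · exact (h1 (Or.inr ((h2 (Or.inr hw)).1 hyz))).1 hxy
    exact (h3 (Or.inl hx)).2 hx
  · intro x _ y _
    obtain ⟨w, hw⟩ := hne {x, y}
    rcases hsub _ ⟨x, by simp⟩ hw with rfl | h
    · exact Or.inl hw
    · right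
      have h : w = y := h
      subst h
      show w ∈ C {w, x}
      rw [Set.pair_comm]; exact hw
  · intro A hA
    ext x
    simp only [minOf, Set.univ_inter, Set.mem_setOf_eq]
    constructor
    · intro hx
      have hxA := hsub A hA hx
      exact ⟨hxA, fun y hy => (key A x y hxA hy (Or.inl hx)).2 hx⟩
    · rintro ⟨hxA, hm⟩
      obtain ⟨y, hy⟩ := hne A
      have hyA := hsub A hA hy
      exact (key A x y hxA hyA (Or.inr hy)).1 (hm y hyA)

/-- A belief change operator is both inherence-limited and
credibility-limited iff it is an AGM revision operator on consistent inputs. -/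
theorem inherence_and_cred_limited_iff_agm {W E : Type*} [Fintype W] [Nonempty W]
    (mod : E → Set W) (hub : Unbiased mod)
    (op : E → Set W → E) :
    (InhLimited mod op ∧ CredLimited mod op) ↔
      ∃ le : E → W → W → Prop,
        (∀ Ψ : E, TotalPreorderOn Set.univ (le Ψ)) ∧
        (∀ Ψ : E, minOf Set.univ (le Ψ) Set.univ = mod Ψ) ∧
        (∀ (Ψ : E) (A : Set W), A.Nonempty →
          mod (op Ψ A) = minOf Set.univ (le Ψ) A) ∧
        (∀ Ψ : E, mod (op Ψ (∅ : Set W)) = mod Ψ) := by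
  constructor
  · rintro ⟨hI, hC⟩
    have hinh := aux_singleton_inh mod hub op hI hC
    have hsub : ∀ Ψ (A : Set W), A.Nonempty → mod (op Ψ A) ⊆ A := by
      rintro Ψ A ⟨w, hw⟩
      exact (hC Ψ {w} A).2.2.2.1 (hinh w Ψ).subset (by simpa using hw)
    have hemp : ∀ Ψ, mod (op Ψ ∅) = mod Ψ := by
      intro Ψ
      rcases (hC Ψ ∅ ∅).1 with h | h
      · exact absurd ((hC Ψ ∅ ∅).2.2.1.mono h) (by simp)
      · exact h
    have hrep := fun Ψ => aux_repr (fun A => mod (op Ψ A)) (hsub Ψ)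
      (fun A => (hC Ψ A ∅).2.2.1) (fun A B => (hC Ψ A B).2.2.2.2)
    refine ⟨fun Ψ x y => x ∈ mod (op Ψ {x, y}), fun Ψ => (hrep Ψ).1, ?_,
      fun Ψ A hA => (hrep Ψ).2 A hA, hemp⟩
    intro Ψ
    refine ((hrep Ψ).2 Set.univ Set.univ_nonempty).symm.trans ?_
    have hne : (mod Ψ).Nonempty := by rw [← hemp Ψ]; exact (hC Ψ ∅ ∅).2.2.1
    have := (hC Ψ Set.univ ∅).2.1 (by simpa using hne)
    simpa using this
  · rintro ⟨le, htp, hmin, hop, hemp⟩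
    have hmne : ∀ Ψ, (mod Ψ).Nonempty := by
      intro Ψ
      rw [← hmin Ψ]; exact aux_min_nonempty _ (htp Ψ) _ Set.univ_nonempty
    have hne : ∀ Ψ A, (mod (op Ψ A)).Nonempty := by
      intro Ψ A
      rcases A.eq_empty_or_nonempty with rfl | hA
      · rw [hemp]; exact hmne Ψ
      · rw [hop Ψ A hA]; exact aux_min_nonempty _ (htp Ψ) _ hA
    have hsub : ∀ Ψ (A : Set W), A.Nonempty → mod (op Ψ A) ⊆ A := by
      intro Ψ A hA
      rw [hop Ψ A hA]
      exact fun x hx => hx.1.2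
    have hinh : ∀ w, Inherent mod op {w} := by
      intro w Γ
      exact ((hne Γ {w}).subset_singleton_iff).1 (hsub Γ {w} ⟨w, rfl⟩)
    have himm := aux_imm mod op hinh
    have htri : ∀ Ψ A B, (mod (op Ψ (A ∪ B)) = mod (op Ψ A) ∨
        mod (op Ψ (A ∪ B)) = mod (op Ψ B) ∨
        mod (op Ψ (A ∪ B)) = mod (op Ψ A) ∪ mod (op Ψ B)) := by
      intro Ψ A B
      rcases A.eq_empty_or_nonempty with rfl | hA
      · right; left; rw [Set.empty_union]
      rcases B.eq_empty_or_nonempty with rfl | hB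
      · left; rw [Set.union_empty]
      rw [hop Ψ A hA, hop Ψ B hB, hop Ψ (A ∪ B) (hA.mono Set.subset_union_left)]
      exact aux_min_tri _ (htp Ψ) A B hA hB
    have hint : ∀ Ψ A, (mod Ψ ∩ A).Nonempty → mod (op Ψ A) = mod Ψ ∩ A := by
      intro Ψ A h
      rw [hop Ψ A (h.mono Set.inter_subset_right), ← hmin Ψ]
      rw [← hmin Ψ] at h
      exact aux_min_inter _ (htp Ψ) A h
    have hor : ∀ Ψ A, mod (op Ψ A) = mod Ψ ∨ mod (op Ψ A) ⊆ A := by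
      intro Ψ A
      rcases A.eq_empty_or_nonempty with rfl | hA
      · exact Or.inl (hemp Ψ)
      · exact Or.inr (hsub Ψ A hA)
    refine ⟨fun Ψ A B => ⟨hor Ψ A, Or.inr (himm _ (hne _ _)), fun h _ => hint Ψ A h,
      fun _ _ => himm _ (hne _ _), fun _ => hne _ _, htri Ψ A B⟩,
      fun Ψ A B => ⟨(hor Ψ A).symm, hint Ψ A, hne _ _, fun h1 h2 => ?_, htri Ψ A B⟩⟩
    exact hsub Ψ B ((hne Ψ A).mono (h1.trans h2))
end
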